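/- Let A and A' be automata with no stuck states. Then the eager-lockstep pre-product of A and A' is adequate. -/

import Mathlib

/-- An automaton: distinct initial and final controls, and a transition relation on
states (control–store pairs) satisfying finality and non-stuttering. -/
structure Automaton (Ctrl : Type*) (Sto : Type*) where
  init : Ctrl
  fin : Ctrl
  init_ne_fin : init ≠ fin
  step : Ctrl × Sto → Ctrl × Sto → Prop
  finality : ∀ {γ β : Ctrl × Sto}, step γ β → γ.1 ≠ fin
  nonstutter : ∀ {γ β : Ctrl × Sto}, step γ β → γ.1 ≠ β.1

variable {Ctrl Sto Ctrl' Sto' : Type*}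

/-- A trace: a nonempty finite sequence of states, consecutive under the transition
relation, whose first state has control `init`. -/
def Automaton.IsTrace (A : Automaton Ctrl Sto) (τ : List (Ctrl × Sto)) : Prop :=
  τ ≠ [] ∧ List.Chain' A.step τ ∧ ∀ h : τ ≠ [], (τ.head h).1 = A.init

/-- A terminated trace: a trace whose last state has control `fin`. -/
def Automaton.IsTerminated (A : Automaton Ctrl Sto) (τ : List (Ctrl × Sto)) : Prop :=
  A.IsTrace τ ∧ ∀ h : τ ≠ [], (τ.getLast h).1 = A.fin

/-- A finite trace satisfies the spec ⟨P,Q⟩ in the basic semantics. -/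
def Automaton.TraceSat (A : Automaton Ctrl Sto) (P Q : Sto → Prop)
    (τ : List (Ctrl × Sto)) : Prop :=
  ∀ h : τ ≠ [], P (τ.head h).2 → (τ.getLast h).1 = A.fin → Q (τ.getLast h).2

/-- An automaton satisfies the spec ⟨P,Q⟩ (basic semantics) iff all its finite traces do. -/
def Automaton.Sat (A : Automaton Ctrl Sto) (P Q : Sto → Prop) : Prop :=
  ∀ τ, A.IsTrace τ → A.TraceSat P Q τ

/-- Traces τ of A and τ' of A' satisfy the relational spec ⟨R,S⟩. -/
def RelTraceSat (A : Automaton Ctrl Sto) (A' : Automaton Ctrl' Sto')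
    (R S : Sto → Sto' → Prop)
    (τ : List (Ctrl × Sto)) (τ' : List (Ctrl' × Sto')) : Prop :=
  ∀ (h : τ ≠ []) (h' : τ' ≠ []),
    R (τ.head h).2 (τ'.head h').2 →
    (τ.getLast h).1 = A.fin → (τ'.getLast h').1 = A'.fin →
    S (τ.getLast h).2 (τ'.getLast h').2

/-- The pair A, A' satisfies the relational spec ⟨R,S⟩ iff all pairs of finite traces do. -/
def RelSat (A : Automaton Ctrl Sto) (A' : Automaton Ctrl' Sto')
    (R S : Sto → Sto' → Prop) : Prop :=
  ∀ τ τ', A.IsTrace τ → A'.IsTrace τ' → RelTraceSat A A' R S τ τ'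

/-- Remove from a list each element equal to its immediate predecessor. -/
noncomputable def destutter {α : Type*} (l : List α) : List α :=
  letI : DecidableRel (α := α) (· ≠ ·) := fun _ _ => Classical.propDecidable _
  List.destutter (· ≠ ·) l

/-- The A-state component of a state of a product of A and A'. -/
def leftSt (γ : (Ctrl × Ctrl') × (Sto × Sto')) : Ctrl × Sto := (γ.1.1, γ.2.1)

/-- The A'-state component of a state of a product of A and A'. -/
def rightSt (γ : (Ctrl × Ctrl') × (Sto × Sto')) : Ctrl' × Sto' := (γ.1.2, γ.2.2)

/-- left(T) = destutter (map fst T). -/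
noncomputable def leftTrace (T : List ((Ctrl × Ctrl') × (Sto × Sto'))) :
    List (Ctrl × Sto) :=
  destutter (T.map leftSt)

/-- right(T) = destutter (map snd T). -/
noncomputable def rightTrace (T : List ((Ctrl × Ctrl') × (Sto × Sto'))) :
    List (Ctrl' × Sto') :=
  destutter (T.map rightSt)

/-- P is a pre-product of A and A': an automaton on control set Ctrl × Ctrl' and
store set Sto × Sto', with initial control (init, init'), final control (fin, fin'),
whose transition relation is contained in (↦ ⊗ ↦') ∪ (↦ ⊗ id) ∪ (id ⊗ ↦'). -/
def IsPreProduct (A : Automaton Ctrl Sto) (A' : Automaton Ctrl' Sto')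
    (P : Automaton (Ctrl × Ctrl') (Sto × Sto')) : Prop :=
  P.init = (A.init, A'.init) ∧ P.fin = (A.fin, A'.fin) ∧
  ∀ γ β, P.step γ β →
    (A.step (leftSt γ) (leftSt β) ∧ A'.step (rightSt γ) (rightSt β)) ∨
    (A.step (leftSt γ) (leftSt β) ∧ rightSt γ = rightSt β) ∨
    (leftSt γ = leftSt β ∧ A'.step (rightSt γ) (rightSt β))

/-- Adequacy: every pair of finite traces of A and A' is covered by some trace of P. -/
def Adequate (A : Automaton Ctrl Sto) (A' : Automaton Ctrl' Sto')
    (P : Automaton (Ctrl × Ctrl') (Sto × Sto')) : Prop :=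
  ∀ τ τ', A.IsTrace τ → A'.IsTrace τ' →
    ∃ T, P.IsTrace T ∧ τ <+: leftTrace T ∧ τ' <+: rightTrace T

/-- Weak adequacy: every pair of finite prefixes of terminated traces of A and A'
(that are themselves traces) is covered by some trace of P. -/
def WeaklyAdequate (A : Automaton Ctrl Sto) (A' : Automaton Ctrl' Sto')
    (P : Automaton (Ctrl × Ctrl') (Sto × Sto')) : Prop :=
  ∀ τ τ', A.IsTrace τ → A'.IsTrace τ' →
    (∃ σ, A.IsTerminated σ ∧ τ <+: σ) →
    (∃ σ', A'.IsTerminated σ' ∧ τ' <+: σ') →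
    ∃ T, P.IsTrace T ∧ τ <+: leftTrace T ∧ τ' <+: rightTrace T

/-- No stuck states: every state whose control is not fin has a successor. -/
def NoStuck (A : Automaton Ctrl Sto) : Prop :=
  ∀ γ : Ctrl × Sto, γ.1 ≠ A.fin → ∃ β, A.step γ β

/-- Only-lockstep transitions: both sides step. -/
def lockstepStep (A : Automaton Ctrl Sto) (A' : Automaton Ctrl' Sto')
    (γ β : (Ctrl × Ctrl') × (Sto × Sto')) : Prop :=
  A.step (leftSt γ) (leftSt β) ∧ A'.step (rightSt γ) (rightSt β)

/-- Interleaved transitions: exactly one side steps. -/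
def interleavedStep (A : Automaton Ctrl Sto) (A' : Automaton Ctrl' Sto')
    (γ β : (Ctrl × Ctrl') × (Sto × Sto')) : Prop :=
  (A.step (leftSt γ) (leftSt β) ∧ rightSt γ = rightSt β) ∨
  (leftSt γ = leftSt β ∧ A'.step (rightSt γ) (rightSt β))

/-- The eager-lockstep pre-product automaton. -/
def Automaton.eagerLockstep (A : Automaton Ctrl Sto) (A' : Automaton Ctrl' Sto') :
    Automaton (Ctrl × Ctrl') (Sto × Sto') where
  init := (A.init, A'.init)
  fin := (A.fin, A'.fin)
  init_ne_fin := fun h => A.init_ne_fin (congrArg Prod.fst h)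
  step γ β :=
    lockstepStep A A' γ β ∨
    ((leftSt γ).1 = A.fin ∧ leftSt γ = leftSt β ∧ A'.step (rightSt γ) (rightSt β)) ∨
    ((rightSt γ).1 = A'.fin ∧ rightSt γ = rightSt β ∧ A.step (leftSt γ) (leftSt β))
  finality := by
    intro γ β h e
    unfold lockstepStep at h
    rcases h with ⟨h, -⟩ | ⟨-, -, h⟩ | ⟨-, -, h⟩
    · exact A.finality h (show γ.1.1 = A.fin by rw [e])
    · exact A'.finality h (show γ.1.2 = A'.fin by rw [e])
    · exact A.finality h (show γ.1.1 = A.fin by rw [e])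
  nonstutter := by
    intro γ β h e
    unfold lockstepStep at h
    rcases h with ⟨h, -⟩ | ⟨-, -, h⟩ | ⟨-, -, h⟩
    · exact A.nonstutter h (show γ.1.1 = β.1.1 by rw [e])
    · exact A'.nonstutter h (show γ.1.2 = β.1.2 by rw [e])
    · exact A.nonstutter h (show γ.1.1 = β.1.1 by rw [e])

theorem destutter_cons_self {α : Type*} (a : α) (l : List α) :
    destutter (a :: a :: l) = destutter (a :: l) := by
  simp [destutter, List.destutter, List.destutter']

theorem destutter_cons_cons_of_ne {α : Type*} {a b : α} (h : a ≠ b) (l : List α) :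
    destutter (a :: b :: l) = a :: destutter (b :: l) := by
  simp [destutter, List.destutter, List.destutter', h]

theorem singleton_prefix_destutter {α : Type*} (a : α) (l : List α) :
    [a] <+: destutter (a :: l) := by
  induction l with
  | nil => simp [destutter]
  | cons b l ih =>
    by_cases h : a = b
    · subst h
      rwa [destutter_cons_self]
    · simp [destutter_cons_cons_of_ne h]

theorem Automaton.cons_prefix_destutter (A : Automaton Ctrl Sto) {a b : Ctrl × Sto}
    {l m : List (Ctrl × Sto)} (hab : A.step a b) (h : b :: l <+: destutter (b :: m)) :
    a :: b :: l <+: destutter (a :: b :: m) := by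
  rw [destutter_cons_cons_of_ne fun e => A.nonstutter hab (congrArg Prod.fst e)]
  exact List.cons_prefix_cons.2 ⟨rfl, h⟩

/-- The product state with given components. -/
def pairSt (a : Ctrl × Sto) (a' : Ctrl' × Sto') : (Ctrl × Ctrl') × (Sto × Sto') :=
  ((a.1, a'.1), (a.2, a'.2))

/-- Without stuck states, any two runs are covered by a run of the eager-lockstep
pre-product starting from the paired state. -/
theorem exists_eagerLockstep_run (A : Automaton Ctrl Sto) (A' : Automaton Ctrl' Sto')
    (hA : NoStuck A) (hA' : NoStuck A') :
    ∀ (l : List (Ctrl × Sto)) (l' : List (Ctrl' × Sto')) (a : Ctrl × Sto) (a' : Ctrl' × Sto'),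
      List.IsChain A.step (a :: l) → List.IsChain A'.step (a' :: l') →
      ∃ T, List.IsChain (A.eagerLockstep A').step (pairSt a a' :: T) ∧
        a :: l <+: destutter (a :: T.map leftSt) ∧
        a' :: l' <+: destutter (a' :: T.map rightSt)
  | [], [], a, a', _, _ =>
    ⟨[], by simp, singleton_prefix_destutter a _, singleton_prefix_destutter a' _⟩
  | b :: l, b' :: l', a, a', h, h' => by
    rw [List.isChain_cons_cons] at h h'
    obtain ⟨T, hT, hl, hr⟩ := exists_eagerLockstep_run A A' hA hA' l l' b b' h.2 h'.2
    exact ⟨pairSt b b' :: T, List.isChain_cons_cons.2 ⟨Or.inl ⟨h.1, h'.1⟩, hT⟩,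
      A.cons_prefix_destutter h.1 hl, A'.cons_prefix_destutter h'.1 hr⟩
  | b :: l, [], a, a', h, _ => by
    rw [List.isChain_cons_cons] at h
    by_cases hf : a'.1 = A'.fin
    · obtain ⟨T, hT, hl, -⟩ := exists_eagerLockstep_run A A' hA hA' l [] b a' h.2 (by simp)
      exact ⟨pairSt b a' :: T,
        List.isChain_cons_cons.2 ⟨Or.inr (Or.inr ⟨hf, rfl, h.1⟩), hT⟩,
        A.cons_prefix_destutter h.1 hl, singleton_prefix_destutter _ _⟩
    · obtain ⟨b', hb'⟩ := hA' a' hf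
      obtain ⟨T, hT, hl, -⟩ := exists_eagerLockstep_run A A' hA hA' l [] b b' h.2 (by simp)
      exact ⟨pairSt b b' :: T, List.isChain_cons_cons.2 ⟨Or.inl ⟨h.1, hb'⟩, hT⟩,
        A.cons_prefix_destutter h.1 hl, singleton_prefix_destutter _ _⟩
  | [], b' :: l', a, a', _, h' => by
    rw [List.isChain_cons_cons] at h'
    by_cases hf : a.1 = A.fin
    · obtain ⟨T, hT, -, hr⟩ := exists_eagerLockstep_run A A' hA hA' [] l' a b' (by simp) h'.2
      exact ⟨pairSt a b' :: T,
        List.isChain_cons_cons.2 ⟨Or.inr (Or.inl ⟨hf, rfl, h'.1⟩), hT⟩,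
        singleton_prefix_destutter _ _, A'.cons_prefix_destutter h'.1 hr⟩
    · obtain ⟨b, hb⟩ := hA a hf
      obtain ⟨T, hT, -, hr⟩ := exists_eagerLockstep_run A A' hA hA' [] l' b b' (by simp) h'.2
      exact ⟨pairSt b b' :: T, List.isChain_cons_cons.2 ⟨Or.inl ⟨hb, h'.1⟩, hT⟩,
        singleton_prefix_destutter _ _, A'.cons_prefix_destutter h'.1 hr⟩
  termination_by l l' => l.length + l'.length

/-- If A and A' have no stuck states then their eager-lockstep pre-product is adequate. -/
theorem eagerLockstep_adequate
    (A : Automaton Ctrl Sto) (A' : Automaton Ctrl' Sto')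
    (hA : NoStuck A) (hA' : NoStuck A') :
    Adequate A A' (A.eagerLockstep A') := by
  rintro (_ | ⟨a, l⟩) (_ | ⟨a', l'⟩) ⟨hne, hc, hi⟩ ⟨hne', hc', hi'⟩
  · exact absurd rfl hne
  · exact absurd rfl hne
  · exact absurd rfl hne'
  · obtain ⟨T, hT, hl, hr⟩ := exists_eagerLockstep_run A A' hA hA' l l' a a' hc hc'
    exact ⟨pairSt a a' :: T,
      ⟨List.cons_ne_nil _ _, hT, fun _ => Prod.ext (hi hne) (hi' hne')⟩, hl, hr⟩
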